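/- If non*(𝒩) ≤ 𝔟 then non*(𝒩) = cov(ℳ). -/

import Mathlib

open Cardinal MeasureTheory Set Filter

/-- `non*(𝒩)`: the least cardinality of a family `X` of Borel functions `f : ℝ → ℝ` such that
for every null `H ⊆ ℝ × ℝ` and every Borel set `B ⊆ ℝ` of positive Lebesgue measure
there is `f ∈ X` with `{x ∈ B : (x, f x) ∉ H}` not Lebesgue-null. -/
noncomputable def nonStarN : Cardinal :=
  sInf { c : Cardinal | ∃ X : Set (ℝ → ℝ), #X = c ∧ (∀ f ∈ X, Measurable f) ∧
    ∀ H : Set (ℝ × ℝ), volume H = 0 → ∀ B : Set ℝ, MeasurableSet B → 0 < volume B →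
      ∃ f ∈ X, volume {x | x ∈ B ∧ (x, f x) ∉ H} ≠ 0 }

/-- The unbounding number `𝔟`. -/
noncomputable def frakb : Cardinal :=
  sInf { c : Cardinal | ∃ F : Set (ℕ → ℕ), #F = c ∧
    ∀ g : ℕ → ℕ, ∃ f ∈ F, ¬ ∀ᶠ n in atTop, f n ≤ g n }

/-- `cov(ℳ)`: the least cardinality of a family of meager subsets of `ℝ` covering `ℝ`. -/
noncomputable def covMeager : Cardinal :=
  sInf { c : Cardinal | ∃ F : Set (Set ℝ), #F = c ∧ (∀ A ∈ F, IsMeagre A) ∧ ⋃₀ F = Set.univ }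

open scoped Topology

/-- The `i`-th Rademacher function, of period `2⁻ⁱ` on the real line. -/
noncomputable def rademacher (i : ℕ) (x : ℝ) : ℝ := (-1 : ℝ) ^ ⌊2 ^ (i + 1) * x⌋

lemma measurable_rademacher (i : ℕ) : Measurable (rademacher i) :=
  (measurable_from_top (f := fun k : ℤ => (-1 : ℝ) ^ k)).comp
    (Int.measurable_floor.comp (measurable_const.mul measurable_id))

lemma rademacher_eq_one_or (i : ℕ) (x : ℝ) : rademacher i x = 1 ∨ rademacher i x = -1 := by
  unfold rademacher
  rcases Int.even_or_odd ⌊2 ^ (i + 1) * x⌋ with h | h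
  · exact .inl h.neg_one_zpow
  · exact .inr h.neg_one_zpow

lemma rademacher_mul_self (i : ℕ) (x : ℝ) : rademacher i x * rademacher i x = 1 := by
  rcases rademacher_eq_one_or i x with h | h <;> simp [h]

lemma rademacher_add_of_even {i : ℕ} {t : ℝ} {k : ℤ} (hk : Even k) (ht : 2 ^ (i + 1) * t = k)
    (x : ℝ) : rademacher i (x + t) = rademacher i x := by
  unfold rademacher
  rw [mul_add, ht, Int.floor_add_intCast, zpow_add₀ (by norm_num), hk.neg_one_zpow, mul_one]

lemma rademacher_add_of_odd {i : ℕ} {t : ℝ} {k : ℤ} (hk : Odd k) (ht : 2 ^ (i + 1) * t = k)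
    (x : ℝ) : rademacher i (x + t) = -rademacher i x := by
  unfold rademacher
  rw [mul_add, ht, Int.floor_add_intCast, zpow_add₀ (by norm_num), hk.neg_one_zpow, mul_neg_one]

lemma rademacher_periodic (i : ℕ) : Function.Periodic (rademacher i) 1 := fun x =>
  rademacher_add_of_even (k := 2 ^ (i + 1)) (by simp [parity_simps]) (by push_cast; ring) x

lemma integral_rademacher_mul_of_lt {i j : ℕ} (hij : i < j) (k : ℝ) :
    ∫ x in k..k + 1, rademacher i x * rademacher j x = 0 := by
  set h : ℝ → ℝ := fun x => rademacher i x * rademacher j x with hh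
  have hper : Function.Periodic h 1 := (rademacher_periodic i).mul (rademacher_periodic j)
  set s : ℝ := (2 ^ (i + 1))⁻¹ with hs
  have hsh : ∀ x, h (x + s) = -h x := by
    intro x
    have h1 : rademacher i (x + s) = -rademacher i x :=
      rademacher_add_of_odd (k := 1) odd_one (by simp [hs]) x
    have h2 : rademacher j (x + s) = rademacher j x := by
      refine rademacher_add_of_even (k := 2 ^ (j - i)) ?_ ?_ x
      · simp [parity_simps]; omega
      · push_cast
        rw [hs, ← div_eq_mul_inv, div_eq_iff (by positivity), ← pow_add]
        congr 1; omega
    simp only [hh, h1, h2]; ring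
  have e1 := hper.intervalIntegral_add_eq k (k + s)
  have e2 : ∫ x in k..k + 1, h (x + s) = ∫ x in k + s..k + s + 1, h x := by
    rw [intervalIntegral.integral_comp_add_right]
    congr 1; ring
  simp only [hsh, intervalIntegral.integral_neg] at e2
  change ∫ x in k..k + 1, h x = 0
  linarith

lemma integral_rademacher_mul (i j : ℕ) (k : ℝ) :
    ∫ x in k..k + 1, rademacher i x * rademacher j x = if i = j then 1 else 0 := by
  rcases lt_trichotomy i j with h | h | h
  · rw [integral_rademacher_mul_of_lt h, if_neg h.ne]
  · subst h
    simp [rademacher_mul_self]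
  · rw [if_neg h.ne', ← integral_rademacher_mul_of_lt h k]
    simp only [mul_comm]

lemma integrable_of_abs_le {s : Set ℝ} {f : ℝ → ℝ} {C : ℝ} (hs : volume s ≠ ⊤)
    (hf : Measurable f) (hC : ∀ x, |f x| ≤ C) : Integrable f (volume.restrict s) := by
  have : IsFiniteMeasure (volume.restrict s) := ⟨by simpa [lt_top_iff_ne_top] using hs⟩
  exact Integrable.of_bound hf.aestronglyMeasurable C (Eventually.of_forall hC)

lemma integral_sum_rademacher_sq (S : Finset ℕ) (k : ℝ) :
    ∫ x in Ioc k (k + 1), (∑ i ∈ S, rademacher i x) ^ 2 = S.card := by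
  have hfin : volume (Ioc k (k + 1)) ≠ ⊤ := by simp
  have hint : ∀ i j, Integrable (fun x => rademacher i x * rademacher j x)
      (volume.restrict (Ioc k (k + 1))) := fun i j => by
    refine integrable_of_abs_le (C := 1) hfin
      ((measurable_rademacher i).mul (measurable_rademacher j)) fun x => ?_
    rcases rademacher_eq_one_or i x with h | h <;> rcases rademacher_eq_one_or j x with h' | h' <;>
      simp [h, h']
  simp only [sq, Finset.sum_mul_sum]
  rw [integral_finsetSum _ fun i _ => integrable_finsetSum _ fun j _ => hint i j]
  have : ∀ i ∈ S, ∫ x in Ioc k (k + 1), ∑ j ∈ S, rademacher i x * rademacher j x = 1 := by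
    intro i hi
    rw [integral_finsetSum _ fun j _ => hint i j]
    have : ∀ j, ∫ x in Ioc k (k + 1), rademacher i x * rademacher j x = if i = j then 1 else 0 :=
      fun j => by
        rw [← integral_rademacher_mul i j k, intervalIntegral.integral_of_le (by linarith)]
    simp [this, hi]
  rw [Finset.sum_congr rfl this]
  simp

/-- A bounded function correlates substantially with only few Rademacher functions. -/
lemma card_mul_sq_le_of_le_integral_rademacher {s : Set ℝ} {k ε : ℝ} {φ : ℝ → ℝ}
    (hsk : s ⊆ Ioc k (k + 1)) (hφ : Measurable φ) (hφ' : ∀ x, |φ x| ≤ 1)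
    (hε : 0 < ε) (S : Finset ℕ) (hS : ∀ i ∈ S, ε ≤ ∫ x in s, rademacher i x * φ x) :
    S.card * ε ^ 2 ≤ 1 := by
  have hI : volume (Ioc k (k + 1)) ≠ ⊤ := by simp
  have hsfin : volume s ≠ ⊤ := measure_ne_top_of_subset hsk hI
  set T : ℝ → ℝ := fun x => ∑ i ∈ S, rademacher i x with hT
  have hTm : Measurable T := Finset.measurable_sum _ fun i _ => measurable_rademacher i
  have hrad : ∀ i x, |rademacher i x| ≤ 1 := fun i x => by
    rcases rademacher_eq_one_or i x with h | h <;> simp [h]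
  have hTb : ∀ x, |T x| ≤ S.card := fun x =>
    (Finset.abs_sum_le_sum_abs _ _).trans ((Finset.sum_le_sum fun i _ => hrad i x).trans (by simp))
  have hT2 : ∀ x, |T x ^ 2| ≤ (S.card : ℝ) ^ 2 := fun x => by
    rw [abs_pow]; exact pow_le_pow_left₀ (abs_nonneg _) (hTb x) 2
  have h1 : S.card * ε ≤ ∫ x in s, T x * φ x := by
    have : ∫ x in s, T x * φ x = ∑ i ∈ S, ∫ x in s, rademacher i x * φ x := by
      simp only [hT, Finset.sum_mul]
      refine integral_finsetSum _ fun i _ => integrable_of_abs_le (C := 1) hsfin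
        ((measurable_rademacher i).mul hφ) fun x => ?_
      rw [abs_mul]; exact mul_le_one₀ (hrad i x) (abs_nonneg _) (hφ' x)
    rw [this]
    simpa using Finset.card_nsmul_le_sum S _ ε hS
  have iT2 : Integrable (fun x => T x ^ 2) (volume.restrict (Ioc k (k + 1))) :=
    integrable_of_abs_le hI (hTm.pow_const 2) hT2
  have h2 : ∫ x in s, T x * φ x ≤ ∫ x in Ioc k (k + 1), (ε / 2 * T x ^ 2 + 1 / (2 * ε)) := by
    have hpt : ∀ x, T x * φ x ≤ ε / 2 * T x ^ 2 + 1 / (2 * ε) := fun x => by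
      have hφ2 : φ x ^ 2 ≤ 1 := (sq_le_one_iff_abs_le_one _).2 (hφ' x)
      have : 0 ≤ (ε * T x - φ x) ^ 2 / (2 * ε) := by positivity
      have e : (ε * T x - φ x) ^ 2 / (2 * ε) =
          ε / 2 * T x ^ 2 - T x * φ x + φ x ^ 2 / (2 * ε) := by field_simp; ring
      have : φ x ^ 2 / (2 * ε) ≤ 1 / (2 * ε) := by gcongr
      linarith
    have iR : Integrable (fun x => ε / 2 * T x ^ 2 + 1 / (2 * ε))
        (volume.restrict (Ioc k (k + 1))) := (iT2.const_mul _).add (integrable_const _)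
    refine (integral_mono ?_ (iR.mono_measure (Measure.restrict_mono hsk le_rfl)) hpt).trans ?_
    · refine integrable_of_abs_le (C := S.card) hsfin (hTm.mul hφ) fun x => ?_
      rw [abs_mul]
      exact (mul_le_of_le_one_right (abs_nonneg _) (hφ' x)).trans (hTb x)
    · exact setIntegral_mono_set iR (Eventually.of_forall fun x => by positivity)
        (LE.le.eventuallyLE hsk)
  rw [integral_add (iT2.const_mul _) (integrable_const _), integral_const_mul,
    integral_sum_rademacher_sq] at h2
  simp at h2
  have h3 : (S.card : ℝ) * ε ≤ ε / 2 * S.card + 1 / (2 * ε) := by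
    refine h1.trans (h2.trans (le_of_eq ?_)); field_simp
  have h4 : (S.card : ℝ) * ε / 2 * (2 * ε) ≤ 1 / (2 * ε) * (2 * ε) :=
    mul_le_mul_of_nonneg_right (by linarith) (by positivity)
  rw [div_mul_cancel₀ _ (by positivity)] at h4
  nlinarith

/-- The proportion of the dyadic cell `[a, a + 2⁻ᵐ)` filled by the section of `U` at `x`. -/
noncomputable def fillRatio (U : Set (ℝ × ℝ)) (m : ℕ) (x a : ℝ) : ℝ :=
  2 ^ m * volume.real (Prod.mk x ⁻¹' U ∩ Ico a (a + (2 ^ m)⁻¹))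

lemma fillRatio_nonneg (U : Set (ℝ × ℝ)) (m : ℕ) (x a : ℝ) : 0 ≤ fillRatio U m x a := by
  unfold fillRatio; positivity

lemma fillRatio_le_one (U : Set (ℝ × ℝ)) (m : ℕ) (x a : ℝ) : fillRatio U m x a ≤ 1 := by
  have h : volume.real (Prod.mk x ⁻¹' U ∩ Ico a (a + (2 ^ m)⁻¹)) ≤ (2 ^ m)⁻¹ :=
    (measureReal_mono inter_subset_right (by simp)).trans_eq (by simp)
  calc fillRatio U m x a ≤ 2 ^ m * (2 ^ m)⁻¹ := by unfold fillRatio; gcongr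
    _ = 1 := mul_inv_cancel₀ (by positivity)

lemma abs_fillRatio_le_one (U : Set (ℝ × ℝ)) (m : ℕ) (x a : ℝ) : |fillRatio U m x a| ≤ 1 := by
  rw [abs_of_nonneg (fillRatio_nonneg U m x a)]
  exact fillRatio_le_one U m x a

lemma fillRatio_eq_average {U : Set (ℝ × ℝ)} (hU : MeasurableSet U) (m : ℕ) (x a : ℝ) :
    fillRatio U m x a =
      (fillRatio U (m + 1) x (a + (2 ^ (m + 1))⁻¹) + fillRatio U (m + 1) x a) / 2 := by
  have hb : a + (2 ^ (m + 1) : ℝ)⁻¹ + (2 ^ (m + 1))⁻¹ = a + (2 ^ m)⁻¹ := by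
    rw [pow_succ]; field_simp; ring
  have hp : (0 : ℝ) < (2 ^ (m + 1))⁻¹ := by positivity
  have hun : Prod.mk x ⁻¹' U ∩ Ico a (a + (2 ^ m)⁻¹) =
      (Prod.mk x ⁻¹' U ∩ Ico a (a + (2 ^ (m + 1))⁻¹)) ∪
      (Prod.mk x ⁻¹' U ∩ Ico (a + (2 ^ (m + 1))⁻¹) (a + (2 ^ (m + 1))⁻¹ + (2 ^ (m + 1))⁻¹)) := by
    rw [← inter_union_distrib_left, Ico_union_Ico_eq_Ico (by linarith) (by linarith), hb]
  unfold fillRatio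
  rw [hun, measureReal_union (Ico_disjoint_Ico_same.mono inter_subset_right inter_subset_right)
    ((measurable_prodMk_left hU).inter measurableSet_Ico)
    (measure_ne_top_of_subset inter_subset_right (by simp))
    (measure_ne_top_of_subset inter_subset_right (by simp)), pow_succ]
  ring

/-- The part of `U` lying above the moving dyadic cell `[a x, a x + 2⁻ᵐ)`. -/
def overCell (U : Set (ℝ × ℝ)) (m : ℕ) (a : ℝ → ℝ) : Set (ℝ × ℝ) :=
  U ∩ {p | p.2 ∈ Ico (a p.1) (a p.1 + (2 ^ m)⁻¹)}

lemma measurableSet_overCell {U : Set (ℝ × ℝ)} (hU : MeasurableSet U) (m : ℕ) {a : ℝ → ℝ}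
    (ha : Measurable a) : MeasurableSet (overCell U m a) :=
  hU.inter ((measurableSet_le (ha.comp measurable_fst) measurable_snd).inter
    (measurableSet_lt measurable_snd ((ha.comp measurable_fst).add_const _)))

lemma fillRatio_eq_overCell (U : Set (ℝ × ℝ)) (m : ℕ) (a : ℝ → ℝ) (x : ℝ) :
    fillRatio U m x (a x) = 2 ^ m * (volume (Prod.mk x ⁻¹' overCell U m a)).toReal := rfl

lemma measurable_fillRatio {U : Set (ℝ × ℝ)} (hU : MeasurableSet U) (m : ℕ) {a : ℝ → ℝ}
    (ha : Measurable a) : Measurable fun x => fillRatio U m x (a x) := by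
  simp only [fillRatio_eq_overCell]
  exact (measurable_measure_prodMk_left (measurableSet_overCell hU m ha)).ennreal_toReal.const_mul _

lemma integral_fillRatio_le {U : Set (ℝ × ℝ)} (hU : MeasurableSet U) (hUfin : volume U ≠ ⊤)
    (m : ℕ) {a : ℝ → ℝ} (ha : Measurable a) (s : Set ℝ) :
    ∫ x in s, fillRatio U m x (a x) ≤ 2 ^ m * (volume U).toReal := by
  simp only [fillRatio_eq_overCell]
  rw [integral_const_mul]
  have hmeas := measurable_measure_prodMk_left (ν := (volume : Measure ℝ))
    (measurableSet_overCell hU m ha)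
  rw [integral_toReal hmeas.aemeasurable]
  · gcongr
    calc ∫⁻ x in s, volume (Prod.mk x ⁻¹' overCell U m a)
        ≤ ∫⁻ x, volume (Prod.mk x ⁻¹' overCell U m a) := setLIntegral_le_lintegral _ _
      _ = volume (overCell U m a) := by
          rw [Measure.volume_eq_prod, Measure.prod_apply (measurableSet_overCell hU m ha)]
      _ ≤ volume U := measure_mono inter_subset_left
  · refine Eventually.of_forall fun x => ?_
    refine (measure_mono (t := Ico (a x) (a x + (2 ^ m)⁻¹)) inter_subset_right).trans_lt ?_
    rw [Real.volume_Ico]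
    exact ENNReal.ofReal_lt_top

lemma eventually_fillRatio_eq_one {U : Set (ℝ × ℝ)} (hU : IsOpen U) {x y : ℝ} (h : (x, y) ∈ U)
    {a : ℕ → ℝ} (ha : ∀ m, a m ≤ y ∧ y ≤ a m + (2 ^ m)⁻¹) :
    ∀ᶠ m in atTop, fillRatio U m x (a m) = 1 := by
  have hV : IsOpen (Prod.mk x ⁻¹' U) := hU.preimage (by fun_prop)
  obtain ⟨δ, hδ, hball⟩ := Metric.isOpen_iff.1 hV y h
  have hlim : Tendsto (fun m : ℕ => ((2 : ℝ) ^ m)⁻¹) atTop (𝓝 0) :=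
    tendsto_inv_atTop_zero.comp (tendsto_pow_atTop_atTop_of_one_lt (by norm_num))
  filter_upwards [hlim.eventually (gt_mem_nhds hδ)] with m hm
  have hsub : Ico (a m) (a m + (2 ^ m)⁻¹) ⊆ Prod.mk x ⁻¹' U := fun w hw => hball (by
    obtain ⟨h1, h2⟩ := ha m
    rw [Metric.mem_ball, Real.dist_eq, abs_lt]
    constructor <;> linarith [hw.1, hw.2])
  unfold fillRatio
  rw [inter_eq_right.2 hsub]
  simp

/-- The partial sums of `randomHash`. -/
noncomputable def partialHash (z : ℕ → ℕ) (m : ℕ) (x : ℝ) : ℝ :=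
  ∑ j ∈ Finset.range m, (1 + rademacher (z j) x) / 2 * (2 ^ (j + 1))⁻¹

/-- The real whose `j`-th binary digit is the value at `x` of the `z j`-th Rademacher function. -/
noncomputable def randomHash (z : ℕ → ℕ) (x : ℝ) : ℝ :=
  ∑' j, (1 + rademacher (z j) x) / 2 * (2 ^ (j + 1))⁻¹

lemma partialHash_succ (z : ℕ → ℕ) (m : ℕ) (x : ℝ) : partialHash z (m + 1) x =
    partialHash z m x + (1 + rademacher (z m) x) / 2 * (2 ^ (m + 1))⁻¹ :=
  Finset.sum_range_succ _ _

lemma measurable_partialHash (z : ℕ → ℕ) (m : ℕ) : Measurable (partialHash z m) :=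
  Finset.measurable_sum _ fun j _ =>
    (((measurable_rademacher (z j)).const_add 1).div_const 2).mul_const _

lemma partialHash_congr {z z' : ℕ → ℕ} {m : ℕ} (h : ∀ j < m, z j = z' j) :
    partialHash z m = partialHash z' m := by
  funext x
  exact Finset.sum_congr rfl fun j hj => by rw [h j (Finset.mem_range.1 hj)]

lemma rademacherDigit_mem (i : ℕ) (x : ℝ) : (1 + rademacher i x) / 2 ∈ Icc (0 : ℝ) 1 := by
  rcases rademacher_eq_one_or i x with h | h <;> norm_num [h]

lemma summable_randomHash (z : ℕ → ℕ) (x : ℝ) :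
    Summable fun j => (1 + rademacher (z j) x) / 2 * ((2 : ℝ) ^ (j + 1))⁻¹ := by
  refine Summable.of_nonneg_of_le (fun j => ?_) (fun j => ?_) (summable_geometric_two)
  · exact mul_nonneg (rademacherDigit_mem _ _).1 (by positivity)
  · calc (1 + rademacher (z j) x) / 2 * ((2 : ℝ) ^ (j + 1))⁻¹ ≤ 1 * ((2 : ℝ) ^ j)⁻¹ := by
          gcongr
          · exact (rademacherDigit_mem _ _).2
          · norm_num
          · omega
      _ = (1 / 2) ^ j := by simp

lemma tendsto_partialHash (z : ℕ → ℕ) (x : ℝ) :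
    Tendsto (fun m => partialHash z m x) atTop (𝓝 (randomHash z x)) :=
  (summable_randomHash z x).hasSum.tendsto_sum_nat

lemma measurable_randomHash (z : ℕ → ℕ) : Measurable (randomHash z) :=
  measurable_of_tendsto_metrizable (measurable_partialHash z)
    (tendsto_pi_nhds.2 (tendsto_partialHash z))

lemma randomHash_mem_cell (z : ℕ → ℕ) (x : ℝ) (m : ℕ) :
    partialHash z m x ≤ randomHash z x ∧
      randomHash z x ≤ partialHash z m x + (2 ^ m)⁻¹ := by
  have hmono : Monotone fun m => partialHash z m x := monotone_nat_of_le_succ fun k => by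
    rw [partialHash_succ]
    have := mul_nonneg (rademacherDigit_mem (z k) x).1 (by positivity : (0 : ℝ) ≤ (2 ^ (k + 1))⁻¹)
    linarith
  have hanti : Antitone fun m => partialHash z m x + ((2 : ℝ) ^ m)⁻¹ :=
    antitone_nat_of_succ_le fun k => by
      rw [partialHash_succ]
      have := mul_le_mul_of_nonneg_right (rademacherDigit_mem (z k) x).2
        (by positivity : (0 : ℝ) ≤ (2 ^ (k + 1))⁻¹)
      have e : ((2 : ℝ) ^ k)⁻¹ = 2 * (2 ^ (k + 1))⁻¹ := by rw [pow_succ]; field_simp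
      rw [e]; linarith
  refine ⟨hmono.ge_of_tendsto (tendsto_partialHash z x) m, ?_⟩
  have hlim : Tendsto (fun m : ℕ => ((2 : ℝ) ^ m)⁻¹) atTop (𝓝 0) :=
    tendsto_inv_atTop_zero.comp (tendsto_pow_atTop_atTop_of_one_lt (by norm_num))
  have := (tendsto_partialHash z x).add hlim
  rw [add_zero] at this
  exact hanti.le_of_tendsto this m

/-- Half the difference of the two halves of the cell selected by `z`. -/
noncomputable def halfDiff (U : Set (ℝ × ℝ)) (z : ℕ → ℕ) (n : ℕ) (x : ℝ) : ℝ :=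
  (fillRatio U (n + 1) x (partialHash z n x + (2 ^ (n + 1))⁻¹) -
    fillRatio U (n + 1) x (partialHash z n x)) / 2

lemma measurable_halfDiff {U : Set (ℝ × ℝ)} (hU : MeasurableSet U) (z : ℕ → ℕ) (n : ℕ) :
    Measurable (halfDiff U z n) :=
  ((measurable_fillRatio hU _ ((measurable_partialHash z n).add_const _)).sub
    (measurable_fillRatio hU _ (measurable_partialHash z n))).div_const 2

lemma abs_halfDiff_le_one (U : Set (ℝ × ℝ)) (z : ℕ → ℕ) (n : ℕ) (x : ℝ) :
    |halfDiff U z n x| ≤ 1 := by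
  unfold halfDiff
  have h1 := fillRatio_nonneg U (n + 1) x (partialHash z n x + (2 ^ (n + 1))⁻¹)
  have h2 := fillRatio_le_one U (n + 1) x (partialHash z n x + (2 ^ (n + 1))⁻¹)
  have h3 := fillRatio_nonneg U (n + 1) x (partialHash z n x)
  have h4 := fillRatio_le_one U (n + 1) x (partialHash z n x)
  rw [abs_le]
  constructor <;> linarith

lemma halfDiff_congr (U : Set (ℝ × ℝ)) {z z' : ℕ → ℕ} {n : ℕ} (h : ∀ j < n, z j = z' j) :
    halfDiff U z n = halfDiff U z' n := by
  funext x
  simp only [halfDiff, partialHash_congr h]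

lemma fillRatio_succ {U : Set (ℝ × ℝ)} (hU : MeasurableSet U) (z : ℕ → ℕ) (n : ℕ) (x : ℝ) :
    fillRatio U (n + 1) x (partialHash z (n + 1) x) =
      fillRatio U n x (partialHash z n x) + rademacher (z n) x * halfDiff U z n x := by
  rw [fillRatio_eq_average hU n, partialHash_succ]
  unfold halfDiff
  rcases rademacher_eq_one_or (z n) x with h | h <;> rw [h] <;> norm_num <;> ring

lemma exists_finset_of_forall_card_le {A : Set ℕ} {N : ℕ}
    (h : ∀ S : Finset ℕ, ↑S ⊆ A → S.card ≤ N) :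
    ∃ S : Finset ℕ, ↑S = A ∧ S.card ≤ N := by
  have hA : A.Finite := by
    by_contra hinf
    obtain ⟨t, ht, hc⟩ := Set.Infinite.exists_subset_card_eq hinf (N + 1)
    have := h t ht
    omega
  exact ⟨hA.toFinset, by simp, h _ (by simp)⟩

/-- The values for the `n`-th entry of `z` that substantially increase the part of `U` filled. -/
def increasingValues (U : Set (ℝ × ℝ)) (s : Set ℝ) (n : ℕ) (z : ℕ → ℕ) : Set ℕ :=
  {i | ((2 : ℝ) ^ n)⁻¹ ≤ ∫ x in s, rademacher i x * halfDiff U z n x}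

lemma exists_finset_eq_increasingValues {U : Set (ℝ × ℝ)} (hU : MeasurableSet U) {s : Set ℝ}
    {k : ℝ} (hs : s ⊆ Ioc k (k + 1)) (n : ℕ) (z : ℕ → ℕ) :
    ∃ S : Finset ℕ, ↑S = increasingValues U s n z ∧ S.card ≤ 4 ^ n := by
  refine exists_finset_of_forall_card_le fun S hS => ?_
  have h := card_mul_sq_le_of_le_integral_rademacher hs (measurable_halfDiff hU z n)
    (abs_halfDiff_le_one U z n) (by positivity : (0 : ℝ) < (2 ^ n)⁻¹) S hS
  rw [inv_pow, ← pow_mul, mul_comm n 2, pow_mul, ← div_eq_mul_inv,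
    div_le_one (by positivity)] at h
  norm_num at h
  exact_mod_cast h

lemma integral_fillRatio_succ {U : Set (ℝ × ℝ)} (hU : MeasurableSet U) {s : Set ℝ}
    (hs : volume s ≠ ⊤) (z : ℕ → ℕ) (n : ℕ) :
    ∫ x in s, fillRatio U (n + 1) x (partialHash z (n + 1) x) =
      (∫ x in s, fillRatio U n x (partialHash z n x)) +
        ∫ x in s, rademacher (z n) x * halfDiff U z n x := by
  simp only [fillRatio_succ hU]
  refine integral_add (integrable_of_abs_le (C := 1) hs
    (measurable_fillRatio hU n (measurable_partialHash z n)) fun x => abs_fillRatio_le_one ..)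
    (integrable_of_abs_le (C := 1) hs
      ((measurable_rademacher _).mul (measurable_halfDiff hU z n)) fun x => ?_)
  rw [abs_mul]
  refine mul_le_one₀ ?_ (abs_nonneg _) (abs_halfDiff_le_one U z n x)
  rcases rademacher_eq_one_or (z n) x with h | h <;> simp [h]

lemma tendsto_integral_fillRatio {U : Set (ℝ × ℝ)} (hU : IsOpen U) {s : Set ℝ}
    (hs : volume s ≠ ⊤) {z : ℕ → ℕ}
    (hz : ∀ᵐ x ∂volume.restrict s, (x, randomHash z x) ∈ U) :
    Tendsto (fun n => ∫ x in s, fillRatio U n x (partialHash z n x)) atTop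
      (𝓝 (volume.real s)) := by
  have : IsFiniteMeasure (volume.restrict s) := ⟨by simpa [lt_top_iff_ne_top] using hs⟩
  have hlim := tendsto_integral_of_dominated_convergence (μ := volume.restrict s)
    (F := fun n x => fillRatio U n x (partialHash z n x)) (f := fun _ => 1) (fun _ => 1)
    (fun n => (measurable_fillRatio hU.measurableSet n
      (measurable_partialHash z n)).aestronglyMeasurable)
    (integrable_const _) (fun n => Eventually.of_forall fun x => abs_fillRatio_le_one ..) (by
      filter_upwards [hz] with x hx
      exact tendsto_const_nhds.congr' ((eventually_fillRatio_eq_one hU hx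
        fun m => randomHash_mem_cell z x m).mono fun _ h => h.symm))
  simpa [Measure.real] using hlim

lemma frequently_mem_increasingValues {U : ℕ → Set (ℝ × ℝ)} (hU : ∀ m, IsOpen (U m))
    (hUvol : ∀ m, volume (U m) ≤ ENNReal.ofReal ((4 ^ m)⁻¹)) {s : Set ℝ}
    (hs : volume s ≠ ⊤) (hs0 : 0 < volume s) {z : ℕ → ℕ}
    (hz : ∀ m, ∀ᵐ x ∂volume.restrict s, (x, randomHash z x) ∈ U m) :
    ∃ᶠ n in atTop, ∃ m ≤ n, z n ∈ increasingValues (U m) s n z := by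
  by_contra hcon
  rw [not_frequently, eventually_atTop] at hcon
  obtain ⟨N, hN⟩ := hcon
  have hbound : ∀ m ≥ N, volume.real s ≤ 3 * ((2 : ℝ) ^ m)⁻¹ := by
    intro m hm
    set v : ℕ → ℝ := fun n => ∫ x in s, fillRatio (U m) n x (partialHash z n x) with hv
    have hmeas := (hU m).measurableSet
    have h0 : v m ≤ ((2 : ℝ) ^ m)⁻¹ := by
      have hfin : volume (U m) ≠ ⊤ := ne_top_of_le_ne_top ENNReal.ofReal_ne_top (hUvol m)
      calc v m ≤ 2 ^ m * (volume (U m)).toReal :=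
            integral_fillRatio_le hmeas hfin m (measurable_partialHash z m) s
        _ ≤ 2 ^ m * (4 ^ m)⁻¹ := by
            gcongr
            exact ENNReal.toReal_le_of_le_ofReal (by positivity) (hUvol m)
        _ = ((2 : ℝ) ^ m)⁻¹ := by
            rw [show (4 : ℝ) = 2 * 2 by norm_num, mul_pow]; field_simp
    have hstep : ∀ j, v (m + j) ≤ 3 * ((2 : ℝ) ^ m)⁻¹ - 2 * (2 ^ (m + j))⁻¹ := by
      intro j
      induction j with
      | zero => simpa using (by linarith : v m ≤ 3 * ((2 : ℝ) ^ m)⁻¹ - 2 * (2 ^ m)⁻¹)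
      | succ j ih =>
        have h1 : v (m + j + 1) = v (m + j) +
            ∫ x in s, rademacher (z (m + j)) x * halfDiff (U m) z (m + j) x :=
          integral_fillRatio_succ hmeas hs z (m + j)
        have h2 := hN (m + j) (by omega)
        push Not at h2
        have h3 := h2 m (by omega)
        rw [increasingValues, mem_ofPred_eq, not_le] at h3
        have e : ((2 : ℝ) ^ (m + j))⁻¹ = 2 * (2 ^ (m + j + 1))⁻¹ := by
          rw [pow_succ]; field_simp
        rw [← add_assoc]
        linarith
    refine le_of_tendsto (tendsto_integral_fillRatio (hU m) hs (hz m)) ?_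
    filter_upwards [eventually_ge_atTop m] with n hn
    obtain ⟨j, rfl⟩ := Nat.exists_eq_add_of_le hn
    refine (hstep j).trans ?_
    have : (0 : ℝ) < (2 ^ (m + j))⁻¹ := by positivity
    linarith
  have hpos : 0 < volume.real s := ENNReal.toReal_pos hs0.ne' hs
  have hlim : Tendsto (fun m : ℕ => 3 * ((2 : ℝ) ^ m)⁻¹) atTop (𝓝 0) := by
    simpa using (tendsto_inv_atTop_zero.comp
      (tendsto_pow_atTop_atTop_of_one_lt (by norm_num : (1 : ℝ) < 2))).const_mul 3
  exact absurd (ge_of_tendsto hlim (eventually_atTop.2 ⟨N, hbound⟩)) (not_le.2 hpos)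

/-- Fewer than `non*(𝒩)` sequences are all infinitely often guessed by a single predictor offering
boundedly many values. -/
theorem exists_predictor_of_mk_lt_nonStarN {Z : Set (ℕ → ℕ)} (hZ : #Z < nonStarN) :
    ∃ W : ℕ → (ℕ → ℕ) → Finset ℕ,
      (∀ n z z', (∀ i < n, z i = z' i) → W n z = W n z') ∧
      (∀ n z, (W n z).card ≤ (n + 1) * 4 ^ n) ∧
      ∀ z ∈ Z, ∃ᶠ n in atTop, z n ∈ W n z := by
  have hX : #(randomHash '' Z) < nonStarN := mk_image_le.trans_lt hZ
  have hnot := notMem_of_lt_csInf' hX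
  simp only [mem_ofPred_eq] at hnot
  push Not at hnot
  obtain ⟨H, hH, B, hB, hB0, hcov⟩ := hnot _ rfl
    (by rintro _ ⟨z, -, rfl⟩; exact measurable_randomHash z)
  obtain ⟨k, hk⟩ : ∃ k : ℤ, volume (B ∩ Ioc (k : ℝ) (k + 1)) ≠ 0 := by
    by_contra! hall
    refine hB0.ne' ?_
    rw [← inter_univ B, ← iUnion_Ioc_intCast ℝ, inter_iUnion]
    exact measure_iUnion_null hall
  set s : Set ℝ := B ∩ Ioc (k : ℝ) (k + 1) with hsdef
  have hsk : s ⊆ Ioc (k : ℝ) (k + 1) := inter_subset_right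
  have hsfin : volume s ≠ ⊤ := measure_ne_top_of_subset hsk (by simp)
  have hex : ∀ m : ℕ, ∃ U ⊇ H, IsOpen U ∧ volume U < ENNReal.ofReal ((4 ^ m)⁻¹) := fun m =>
    Set.exists_isOpen_lt_of_lt H _ (by rw [hH]; simp)
  choose U hHU hUo hUv using hex
  choose S hS hScard using fun (m n : ℕ) (z : ℕ → ℕ) =>
    exists_finset_eq_increasingValues (hUo m).measurableSet hsk n z
  refine ⟨fun n z => (Finset.range (n + 1)).biUnion fun m => S m n z, ?_, ?_, ?_⟩
  · intro n z z' h
    refine Finset.biUnion_congr rfl fun m _ => ?_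
    rw [← Finset.coe_inj, hS, hS]
    simp only [increasingValues, halfDiff_congr _ h]
  · intro n z
    simpa using Finset.card_biUnion_le_card_mul (Finset.range (n + 1)) (fun m => S m n z) (4 ^ n)
      fun m _ => hScard m n z
  · intro z hz
    have hz' : ∀ m, ∀ᵐ x ∂volume.restrict s, (x, randomHash z x) ∈ U m := by
      intro m
      rw [ae_restrict_iff' (hB.inter measurableSet_Ioc), ae_iff]
      refine measure_mono_null (fun x hx => ?_) (hcov _ (mem_image_of_mem _ hz))
      rw [mem_ofPred_eq, Classical.not_imp] at hx
      exact ⟨hx.1.1, fun h => hx.2 (hHU m h)⟩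
    refine (frequently_mem_increasingValues hUo (fun m => (hUv m).le) hsfin
      (pos_iff_ne_zero.2 hk) hz').mono fun n ⟨m, hm, h⟩ => ?_
    rw [Finset.mem_biUnion]
    exact ⟨m, Finset.mem_range.2 (by omega), by rw [← Finset.mem_coe, hS]; exact h⟩

/-- Block endpoints such that the `n`-th block has room for `(n + 1) * 4 ^ n` guesses for each
sequence bounded by `N` of length the start of the block. -/
def blockStart (N : ℕ → ℕ) : ℕ → ℕ
  | 0 => 0
  | n + 1 => blockStart N n + (∏ j ∈ Finset.range (blockStart N n), N j) * ((n + 1) * 4 ^ n)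

lemma strictMono_blockStart {N : ℕ → ℕ} (hN : ∀ j, 0 < N j) : StrictMono (blockStart N) :=
  strictMono_nat_of_lt_succ fun n => by
    rw [blockStart]
    have : 0 < ∏ j ∈ Finset.range (blockStart N n), N j := Finset.prod_pos fun j _ => hN j
    have : 0 < (∏ j ∈ Finset.range (blockStart N n), N j) * ((n + 1) * 4 ^ n) := by positivity
    omega

/-- A code for the restriction of `c` to `{0, …, l - 1}`. -/
def prefixCode (c : ℕ → ℕ) (l : ℕ) : ℕ := Encodable.encode ((List.range l).map c)

/-- Reads off an entry of a finite sequence from its code. -/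
def prefixEntry (w j : ℕ) : ℕ := (((Encodable.decode w : Option (List ℕ)).getD []).getD j 0)

lemma prefixEntry_prefixCode (c : ℕ → ℕ) {l j : ℕ} (h : j < l) :
    prefixEntry (prefixCode c l) j = c j := by
  simp [prefixEntry, prefixCode, h]

lemma prefixCode_congr {c c' : ℕ → ℕ} {l : ℕ} (h : ∀ j < l, c j = c' j) :
    prefixCode c l = prefixCode c' l := by
  unfold prefixCode
  rw [List.map_congr_left fun j hj => h j (List.mem_range.1 hj)]

/-- A set of at most `l` sequence codes can be guessed by a single sequence along any interval
of length `l`. -/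
lemma exists_seq_meeting_codes (V : Finset ℕ) {v v' : ℕ} (hV : V.card ≤ v' - v) :
    ∃ x : ℕ → ℕ, ∀ c : ℕ → ℕ, prefixCode c v' ∈ V → ∃ j, v ≤ j ∧ j < v' ∧ x j = c j := by
  refine ⟨fun j => prefixEntry (V.toList.getD (j - v) 0) j, fun c hc => ?_⟩
  obtain ⟨i, hi, he⟩ := List.getElem_of_mem (Finset.mem_toList.2 hc)
  have hi' : i < V.card := by simpa using hi
  refine ⟨v + i, by omega, by omega, ?_⟩
  have : V.toList.getD (v + i - v) 0 = prefixCode c v' := by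
    rw [Nat.add_sub_cancel_left, List.getD_eq_getElem _ _ hi, he]
  simp only [this]
  exact prefixEntry_prefixCode c (by omega)

/-- Fewer than `non*(𝒩)` sequences below a fixed bound are all infinitely often equal to a single
sequence. -/
theorem exists_frequently_eq_of_mk_lt_nonStarN {N : ℕ → ℕ} (hN : ∀ j, 0 < N j)
    {C : Set (ℕ → ℕ)} (hC : ∀ c ∈ C, ∀ j, c j < N j) (hcard : #C < nonStarN) :
    ∃ x : ℕ → ℕ, ∀ c ∈ C, ∃ᶠ j in atTop, x j = c j := by
  set v := blockStart N with hv
  have hmono : StrictMono v := strictMono_blockStart hN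
  let code : (ℕ → ℕ) → ℕ → ℕ := fun c n => prefixCode c (v (n + 1))
  obtain ⟨W, hWloc, hWcard, hW⟩ := exists_predictor_of_mk_lt_nonStarN (Z := code '' C)
    (mk_image_le.trans_lt hcard)
  let P : ∀ n, Finset (Fin (v n) → ℕ) := fun n => Fintype.piFinset fun j => Finset.range (N j)
  let pad : ∀ n, (Fin (v n) → ℕ) → ℕ → ℕ := fun n p j => if h : j < v n then p ⟨j, h⟩ else 0
  let V : ℕ → Finset ℕ := fun n => (P n).biUnion fun p => W n (code (pad n p))
  have hV : ∀ n, (V n).card ≤ v (n + 1) - v n := by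
    intro n
    refine (Finset.card_biUnion_le_card_mul _ _ _ fun p _ => hWcard n _).trans_eq ?_
    rw [Fintype.card_piFinset]
    simp only [Finset.card_range]
    rw [Fin.prod_univ_eq_prod_range, hv, blockStart, Nat.add_sub_cancel_left]
  have hmem : ∀ c ∈ C, ∀ n, code c n ∈ W n (code c) → code c n ∈ V n := by
    intro c hc n h
    refine Finset.mem_biUnion.2 ⟨fun j => c j, ?_, ?_⟩
    · exact Fintype.mem_piFinset.2 fun j => Finset.mem_range.2 (hC c hc j)
    · rwa [hWloc n _ (code c)]
      intro i hi
      refine prefixCode_congr fun j hj => ?_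
      have : j < v n := hj.trans_le (hmono.monotone hi)
      simp [pad, this]
  choose x hx using fun n => exists_seq_meeting_codes (V n) (hV n)
  have hidx : ∀ j, ∃ n, j < v (n + 1) := fun j => ⟨j, hmono.le_apply⟩
  refine ⟨fun j => x (Nat.find (hidx j)) j, fun c hc => ?_⟩
  rw [frequently_atTop]
  intro a
  obtain ⟨n, hn, hcode⟩ := frequently_atTop.1 (hW _ (mem_image_of_mem _ hc)) a
  obtain ⟨j, hj, hj', he⟩ := hx n c (hmem c hc n hcode)
  refine ⟨j, hn.trans (hmono.le_apply.trans hj), ?_⟩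
  have : Nat.find (hidx j) = n := (Nat.find_eq_iff _).2
    ⟨hj', fun m hm => not_lt.2 ((hmono.monotone hm).trans hj)⟩
  change x (Nat.find (hidx j)) j = c j
  rw [this, he]

/-- In every dyadic interval of level `l` in the unit interval, the `c`-th subinterval of level
`l'` is contained in `D`. -/
def IsDyadicHit (D : Set ℝ) (l l' c : ℕ) : Prop :=
  c < 2 ^ (l' - l) ∧ ∀ a < 2 ^ l,
    Icc (((a * 2 ^ (l' - l) + c : ℕ) : ℝ) / 2 ^ l') (((a * 2 ^ (l' - l) + c : ℕ) + 1 : ℝ) / 2 ^ l')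
      ⊆ D

lemma IsDyadicHit.refine {D : Set ℝ} {l l' l'' c : ℕ} (h : IsDyadicHit D l l' c) (hl : l ≤ l')
    (hl' : l' ≤ l'') : IsDyadicHit D l l'' (c * 2 ^ (l'' - l')) := by
  obtain ⟨d, rfl⟩ := Nat.exists_eq_add_of_le hl
  obtain ⟨e, rfl⟩ := Nat.exists_eq_add_of_le hl'
  obtain ⟨h1, h2⟩ := h
  unfold IsDyadicHit
  simp only [Nat.add_sub_cancel_left, show l + d + e - l = d + e by omega] at h1 h2 ⊢
  refine ⟨by rw [pow_add]; gcongr, fun a ha => (Icc_subset_Icc ?_ ?_).trans (h2 a ha)⟩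
  · refine le_of_eq ?_
    rw [div_eq_div_iff (by positivity) (by positivity)]
    push_cast; ring
  · rw [div_le_div_iff₀ (by positivity) (by positivity)]
    have : (1 : ℝ) ≤ 2 ^ e := one_le_pow₀ (by norm_num)
    have h3 : (0 : ℝ) < 2 ^ (l + d) := by positivity
    rw [pow_add (2 : ℝ) (l + d) e]
    push_cast
    rw [pow_add]
    nlinarith

lemma exists_isDyadicHit {D : Set ℝ} (hD : IsOpen D) (hD' : Dense D) (l : ℕ) :
    ∃ l' c, l ≤ l' ∧ IsDyadicHit D l l' c := by
  let E : Set ℝ := ⋂ a : Fin (2 ^ l), (fun x : ℝ => x + (a : ℕ) / 2 ^ l) ⁻¹' D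
  have ho : ∀ a : Fin (2 ^ l), IsOpen ((fun x : ℝ => x + (a : ℕ) / 2 ^ l) ⁻¹' D) := fun a =>
    hD.preimage (by fun_prop)
  have hEo : IsOpen E := isOpen_iInter_of_finite ho
  have hEd : Dense E := dense_iInter_of_isOpen ho fun a =>
    hD'.preimage (Homeomorph.addRight _).isOpenMap
  obtain ⟨x, hx, hxE⟩ := hEd.inter_open_nonempty (Ioo 0 (2 ^ l)⁻¹) isOpen_Ioo
    (nonempty_Ioo.2 (by positivity))
  obtain ⟨δ, hδ, hball⟩ := Metric.isOpen_iff.1 hEo x hxE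
  obtain ⟨m, hm⟩ := exists_pow_lt_of_lt_one hδ (by norm_num : (1 / 2 : ℝ) < 1)
  set l' := l + m with hl'
  have hpos : (0 : ℝ) < 2 ^ l' := by positivity
  have hsmall : 1 / (2 : ℝ) ^ l' < δ := by
    refine lt_of_le_of_lt ?_ hm
    rw [← one_div_pow]
    exact pow_le_pow_of_le_one (by norm_num) (by norm_num) (by omega)
  set c := ⌊x * 2 ^ l'⌋₊ with hc
  have hc1 : (c : ℝ) ≤ x * 2 ^ l' := Nat.floor_le (mul_nonneg hx.1.le hpos.le)
  have hc2 : x * 2 ^ l' < c + 1 := Nat.lt_floor_add_one _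
  refine ⟨l', c, by omega, ?_, fun a ha y hy => ?_⟩
  · have : x * 2 ^ l' < 2 ^ m := by
      calc x * 2 ^ l' < (2 ^ l)⁻¹ * 2 ^ l' := by gcongr; exact hx.2
        _ = 2 ^ m := by rw [hl', pow_add]; field_simp
    rw [show l' - l = m by omega]
    exact_mod_cast hc1.trans_lt this
  · have e : (((a * 2 ^ (l' - l) + c : ℕ) : ℝ)) / 2 ^ l' = a / 2 ^ l + c / 2 ^ l' := by
      rw [show l' - l = m by omega, hl', pow_add]; push_cast; field_simp
    rw [add_div, e, mem_Icc] at hy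
    have h1 : (c : ℝ) / 2 ^ l' ≤ x := (div_le_iff₀ hpos).2 hc1
    have h2 : x < c / 2 ^ l' + 1 / 2 ^ l' := by rw [← add_div]; exact (lt_div_iff₀ hpos).2 hc2
    have hy' : y - a / 2 ^ l ∈ E := hball (by
      rw [Metric.mem_ball, Real.dist_eq, abs_lt]; constructor <;> linarith [hy.1, hy.2])
    simpa using mem_iInter.1 hy' ⟨a, ha⟩

lemma IsMeagre.exists_seq_isOpen_dense {A : Set ℝ} (hA : IsMeagre A) :
    ∃ D : ℕ → Set ℝ, (∀ n, IsOpen (D n)) ∧ (∀ n, Dense (D n)) ∧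
      ∀ x, (∃ᶠ n in atTop, x ∈ D n) → x ∉ A := by
  obtain ⟨S, hSo, hSd, hSc, hS⟩ := mem_residual_iff.1 hA
  obtain ⟨f, hf⟩ := (hSc.insert Set.univ).exists_eq_range (insert_nonempty _ _)
  have hfo : ∀ i, IsOpen (f i) ∧ Dense (f i) := fun i => by
    have : f i ∈ insert Set.univ S := hf ▸ mem_range_self i
    rcases this with h | h
    · rw [h]; exact ⟨isOpen_univ, dense_univ⟩
    · exact ⟨hSo _ h, hSd _ h⟩
  refine ⟨fun n => ⋂ i : Fin (n + 1), f i, fun n => isOpen_iInter_of_finite fun i => (hfo i).1,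
    fun n => dense_iInter_of_isOpen (fun i => (hfo i).1) fun i => (hfo i).2, fun x hx => ?_⟩
  refine hS fun t ht => ?_
  obtain ⟨i, rfl⟩ : t ∈ range f := hf ▸ mem_insert_of_mem _ ht
  obtain ⟨n, hn, hxn⟩ := frequently_atTop.1 hx i
  exact mem_iInter.1 hxn ⟨i, by omega⟩

lemma exists_eventually_le_of_mk_lt_frakb {F : Set (ℕ → ℕ)} (hF : #F < frakb) :
    ∃ g : ℕ → ℕ, ∀ f ∈ F, ∀ᶠ n in atTop, f n ≤ g n := by
  by_contra! hcon
  exact notMem_of_lt_csInf' hF ⟨F, rfl, fun g => by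
    obtain ⟨f, hf, h⟩ := hcon g
    exact ⟨f, hf, fun h' => h.and_eventually h' |>.exists.elim fun n hn =>
      absurd hn.2 (not_le.2 hn.1)⟩⟩

/-- Numerators of the nested dyadic intervals with levels `u` and successive positions `y`. -/
def dyadicNumerator (u y : ℕ → ℕ) : ℕ → ℕ
  | 0 => 0
  | j + 1 => dyadicNumerator u y j * 2 ^ (u (j + 1) - u j) + y j

lemma dyadicNumerator_lt {u y : ℕ → ℕ} (hu : Monotone u)
    (hy : ∀ j, y j < 2 ^ (u (j + 1) - u j)) (j : ℕ) : dyadicNumerator u y j < 2 ^ u j := by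
  induction j with
  | zero => simp [dyadicNumerator]
  | succ j ih =>
    have h1 : 2 ^ u (j + 1) = 2 ^ u j * 2 ^ (u (j + 1) - u j) := by
      rw [← pow_add, Nat.add_sub_cancel' (hu j.le_succ)]
    rw [dyadicNumerator, h1]
    nlinarith [hy j]

lemma exists_mem_dyadic_Icc {u y : ℕ → ℕ} (hu : Monotone u)
    (hy : ∀ j, y j < 2 ^ (u (j + 1) - u j)) :
    ∃ p : ℝ, ∀ j, p ∈ Icc ((dyadicNumerator u y j : ℝ) / 2 ^ u j)
      ((dyadicNumerator u y j + 1 : ℝ) / 2 ^ u j) := by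
  have hpow : ∀ j, (2 : ℝ) ^ u (j + 1) = 2 ^ u j * 2 ^ (u (j + 1) - u j) := fun j => by
    rw [← pow_add, Nat.add_sub_cancel' (hu j.le_succ)]
  have hanti : Antitone fun j => Icc ((dyadicNumerator u y j : ℝ) / 2 ^ u j)
      ((dyadicNumerator u y j + 1 : ℝ) / 2 ^ u j) := by
    refine antitone_nat_of_succ_le fun j => Icc_subset_Icc ?_ ?_
    · rw [div_le_div_iff₀ (by positivity) (by positivity), dyadicNumerator, hpow]
      push_cast
      have : (0 : ℝ) ≤ y j * 2 ^ u j := by positivity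
      linarith
    · rw [div_le_div_iff₀ (by positivity) (by positivity), dyadicNumerator, hpow]
      push_cast
      have h1 : (y j : ℝ) + 1 ≤ 2 ^ (u (j + 1) - u j) := by exact_mod_cast hy j
      have h2 : (0 : ℝ) < 2 ^ u j := by positivity
      nlinarith
  exact ⟨_, mem_iInter.1
    (ciSup_mem_iInter_Icc_of_antitone_Icc hanti fun j => by gcongr; linarith)⟩

theorem sUnion_ne_univ_of_mk_lt {F : Set (Set ℝ)} (hF : ∀ A ∈ F, IsMeagre A)
    (hb : #F < frakb) (hn : #F < nonStarN) : ⋃₀ F ≠ Set.univ := by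
  choose D hDo hDd hD using fun A : F => (hF A A.2).exists_seq_isOpen_dense
  choose h c hle hhit using fun (A : F) (l : ℕ) => exists_isDyadicHit (hDo A l) (hDd A l) l
  obtain ⟨g, hg⟩ := exists_eventually_le_of_mk_lt_frakb (mk_range_le (f := h) |>.trans_lt hb)
  let u : ℕ → ℕ := fun j => Nat.rec 0 (fun _ l => max (g l) (l + 1)) j
  have hus : ∀ j, u (j + 1) = max (g (u j)) (u j + 1) := fun _ => rfl
  have hu : StrictMono u := strictMono_nat_of_lt_succ fun j => by rw [hus]; omega
  have hev : ∀ A : F, ∀ᶠ j in atTop, ∃ k, IsDyadicHit (D A (u j)) (u j) (u (j + 1)) k := fun A => by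
    filter_upwards [hu.tendsto_atTop.eventually (hg _ (mem_range_self A))] with j hj
    exact ⟨_, (hhit A (u j)).refine (hle A _) (hj.trans (by rw [hus]; exact le_max_left _ _))⟩
  have hk : ∀ (A : F) (j : ℕ), ∃ k < 2 ^ (u (j + 1) - u j),
      (∃ k, IsDyadicHit (D A (u j)) (u j) (u (j + 1)) k) →
        IsDyadicHit (D A (u j)) (u j) (u (j + 1)) k := fun A j => by
    by_cases hex : ∃ k, IsDyadicHit (D A (u j)) (u j) (u (j + 1)) k
    · obtain ⟨k, hk⟩ := hex
      exact ⟨k, hk.1, fun _ => hk⟩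
    · exact ⟨0, by positivity, fun h => absurd h hex⟩
  choose k hklt hkhit using hk
  obtain ⟨x, hx⟩ := exists_frequently_eq_of_mk_lt_nonStarN (N := fun j => 2 ^ (u (j + 1) - u j))
    (fun j => by positivity) (C := range k) (by rintro _ ⟨A, rfl⟩; exact hklt A)
    (mk_range_le.trans_lt hn)
  let y : ℕ → ℕ := fun j => if x j < 2 ^ (u (j + 1) - u j) then x j else 0
  have hy : ∀ j, y j < 2 ^ (u (j + 1) - u j) := fun j => by
    simp only [y]; split_ifs with hlt
    · exact hlt
    · positivity
  obtain ⟨p, hp⟩ := exists_mem_dyadic_Icc hu.monotone hy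
  intro huniv
  obtain ⟨A, hAF, hpA⟩ := mem_sUnion.1 (huniv.symm ▸ mem_univ p)
  refine hD ⟨A, hAF⟩ p (hu.tendsto_atTop.frequently ?_) hpA
  refine ((hx _ (mem_range_self ⟨A, hAF⟩)).and_eventually (hev ⟨A, hAF⟩)).mono fun j hj => ?_
  have hyj : y j = k ⟨A, hAF⟩ j := by
    simp only [y, hj.1, if_pos (hklt ⟨A, hAF⟩ j)]
  refine (hkhit ⟨A, hAF⟩ j hj.2).2 _ (dyadicNumerator_lt hu.monotone hy j) ?_
  have := hp (j + 1)
  rwa [dyadicNumerator, hyj] at this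

/-- Reads a sequence of naturals off a real number. -/
noncomputable def fractDigits (x : ℝ) (n : ℕ) : ℕ := ⌊(Int.fract (n * x))⁻¹⌋₊ - 1

lemma fractDigits_eq {x : ℝ} {n k : ℕ} {a : ℤ} (h₁ : a + ((k : ℝ) + 2)⁻¹ < n * x)
    (h₂ : n * x < a + ((k : ℝ) + 1)⁻¹) : fractDigits x n = k := by
  have h0 : (0 : ℝ) < ((k : ℝ) + 2)⁻¹ := by positivity
  have h1 : ((k : ℝ) + 1)⁻¹ ≤ 1 := inv_le_one_of_one_le₀ (by linarith [Nat.cast_nonneg (α := ℝ) k])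
  have hfl : ⌊n * x⌋ = a := Int.floor_eq_iff.2 ⟨by linarith, by linarith⟩
  have hfr : Int.fract (n * x) = n * x - a := by rw [← Int.self_sub_floor, hfl]
  have hpos : 0 < Int.fract (n * x) := by rw [hfr]; linarith
  have : ⌊(Int.fract (n * x))⁻¹⌋₊ = k + 1 := by
    refine (Nat.floor_eq_iff (inv_nonneg.2 hpos.le)).2 ⟨?_, ?_⟩
    · push_cast
      exact (le_inv_comm₀ (by positivity) hpos).2 (by rw [hfr]; linarith)
    · push_cast
      rw [inv_lt_comm₀ hpos (by positivity), hfr]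
      ring_nf at h₁ ⊢
      linarith
  rw [fractDigits, this, Nat.add_sub_cancel]

lemma isMeagre_setOf_eventually_fractDigits_ne (g : ℕ → ℕ) :
    IsMeagre {x | ∀ᶠ n in atTop, fractDigits x n ≠ g n} := by
  let U : ℕ → Set ℝ := fun n => ⋃ a : ℤ,
    (fun x : ℝ => n * x) ⁻¹' Ioo (a + ((g n : ℝ) + 2)⁻¹) (a + ((g n : ℝ) + 1)⁻¹)
  have hU : ∀ n, IsOpen (U n) := fun n =>
    isOpen_iUnion fun a => isOpen_Ioo.preimage (by fun_prop)
  have hdense : ∀ N, Dense (⋃ n ≥ N, U n) := by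
    intro N
    refine dense_of_exists_between fun {p q} hpq => ?_
    obtain ⟨m, hm⟩ := exists_nat_gt (2 / (q - p))
    set n := max N m
    have hqp : 0 < q - p := sub_pos.2 hpq
    have hn : 2 / (q - p) < n := hm.trans_le (by exact_mod_cast le_max_right _ _)
    have hn0 : (0 : ℝ) < n := (by positivity : (0 : ℝ) < 2 / (q - p)).trans hn
    rw [div_lt_iff₀ hqp] at hn
    have hlt : ((g n : ℝ) + 2)⁻¹ < ((g n : ℝ) + 1)⁻¹ :=
      inv_strictAnti₀ (by positivity) (by linarith)
    obtain ⟨t, ht₁, ht₂⟩ := exists_between hlt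
    have h0 : (0 : ℝ) < ((g n : ℝ) + 2)⁻¹ := by positivity
    have h1 : ((g n : ℝ) + 1)⁻¹ ≤ 1 :=
      inv_le_one_of_one_le₀ (by linarith [Nat.cast_nonneg (α := ℝ) (g n)])
    have hf₁ := Int.lt_floor_add_one (n * p)
    have hf₂ := Int.floor_le (n * p)
    refine ⟨((⌊n * p⌋ + 1 : ℤ) + t) / n, mem_iUnion₂.2 ⟨n, le_max_left _ _, mem_iUnion.2
      ⟨⌊n * p⌋ + 1, ?_⟩⟩, ?_, ?_⟩
    · rw [mem_preimage, mul_div_cancel₀ _ hn0.ne']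
      exact ⟨by linarith, by linarith⟩
    · rw [lt_div_iff₀ hn0]; push_cast; linarith
    · rw [div_lt_iff₀ hn0]; push_cast; linarith
  have hres : (⋂ N, ⋃ n ≥ N, U n) ∈ residual ℝ :=
    countable_iInter_mem.2 fun N =>
      residual_of_dense_open (isOpen_biUnion fun n _ => hU n) (hdense N)
  refine mem_of_superset hres fun x hx => ?_
  simp only [mem_compl_iff, mem_ofPred_eq, not_eventually, not_not, frequently_atTop]
  intro N
  obtain ⟨n, hn, hxn⟩ := mem_iUnion₂.1 (mem_iInter.1 hx N)
  obtain ⟨a, ha⟩ := mem_iUnion.1 hxn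
  exact ⟨n, hn, fractDigits_eq ha.1 ha.2⟩

lemma exists_frequently_eq_of_mk_lt_covMeager {G : Set (ℕ → ℕ)} (hG : #G < covMeager) :
    ∃ F : ℕ → ℕ, ∀ g ∈ G, ∃ᶠ n in atTop, F n = g n := by
  let M : (ℕ → ℕ) → Set ℝ := fun g => {x | ∀ᶠ n in atTop, fractDigits x n ≠ g n}
  have hne : ⋃₀ (M '' G) ≠ Set.univ := fun h => notMem_of_lt_csInf' (mk_image_le.trans_lt hG)
    ⟨M '' G, rfl, by rintro _ ⟨g, -, rfl⟩; exact isMeagre_setOf_eventually_fractDigits_ne g, h⟩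
  obtain ⟨x, hx⟩ := (ne_univ_iff_exists_notMem _).1 hne
  refine ⟨fractDigits x, fun g hg => ?_⟩
  by_contra h
  exact hx ⟨M g, mem_image_of_mem M hg, not_frequently.1 h⟩

lemma tendsto_measure_norm_gt_zero {α : Type*} [MeasurableSpace α] (μ : Measure α)
    [IsFiniteMeasure μ] {f : α → ℝ} (hf : Measurable f) :
    Tendsto (fun n : ℕ => μ {x | (n : ℝ) < |f x|}) atTop (𝓝 0) := by
  have h := tendsto_measure_iInter_atTop (μ := μ) (s := fun n : ℕ => {x | (n : ℝ) < |f x|})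
    (fun n => (measurableSet_lt measurable_const hf.abs).nullMeasurableSet)
    (fun m n hmn x (hx : (n : ℝ) < |f x|) => (Nat.cast_le.2 hmn : (m : ℝ) ≤ n).trans_lt hx)
    ⟨0, measure_ne_top _ _⟩
  have hempty : ⋂ n : ℕ, {x | (n : ℝ) < |f x|} = ∅ := by
    refine eq_empty_of_forall_notMem fun x hx => ?_
    obtain ⟨n, hn⟩ := exists_nat_gt |f x|
    exact lt_asymm hn (mem_iInter.1 hx n)
  rwa [hempty, measure_empty] at h

lemma exists_seq_dense_in_measure {α : Type*} [MeasurableSpace α]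
    [MeasurableSpace.CountablyGenerated α] (μ : Measure α) [IsFiniteMeasure μ] :
    ∃ d : ℕ → α → ℝ, (∀ i, Measurable (d i)) ∧ ∀ f : α → ℝ, Measurable f → ∀ ε : ℝ, 0 < ε →
      ∃ i, μ {x | ε ≤ |f x - d i x|} ≤ ENNReal.ofReal ε := by
  have : Fact ((1 : ENNReal) ≠ ⊤) := ⟨by simp⟩
  let e := TopologicalSpace.denseSeq (Lp ℝ 1 μ)
  refine ⟨fun i => e i, fun i => (Lp.stronglyMeasurable (e i)).measurable, fun f hf ε hε => ?_⟩
  have hε2 : 0 < ENNReal.ofReal (ε / 2) := by simpa using half_pos hε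
  obtain ⟨N, hN⟩ := ((tendsto_measure_norm_gt_zero μ hf).eventually (gt_mem_nhds hε2)).exists
  let A := {x | |f x| ≤ (N : ℝ)}
  have hA : MeasurableSet A := measurableSet_le hf.abs measurable_const
  let h := A.indicator f
  have hh : MemLp h 1 μ := by
    refine MemLp.of_bound (hf.indicator hA).aestronglyMeasurable N (ae_of_all _ fun x => ?_)
    by_cases hx : x ∈ A
    · rw [show h x = f x from indicator_of_mem hx f]
      exact hx
    · simp [h, hx]
  have hδ : 0 < ENNReal.ofReal ε * ENNReal.ofReal (ε / 2) :=
    ENNReal.mul_pos (by simpa using hε) hε2.ne'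
  obtain ⟨i, hi⟩ := (TopologicalSpace.denseRange_denseSeq (Lp ℝ 1 μ)).exists_mem_open
    (Metric.isOpen_eball (x := hh.toLp h)) ⟨_, Metric.mem_eball_self hδ⟩
  refine ⟨i, ?_⟩
  have hnorm : eLpNorm (fun x => h x - e i x) 1 μ < ENNReal.ofReal ε * ENNReal.ofReal (ε / 2) := by
    rw [Metric.mem_eball, edist_comm, Lp.edist_def] at hi
    refine lt_of_eq_of_lt (eLpNorm_congr_ae ?_) hi
    filter_upwards [hh.coeFn_toLp] with x hx
    simp [hx, e]
  have hmarkov := mul_meas_ge_le_lintegral₀ (μ := μ) (f := fun x => ‖h x - e i x‖ₑ)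
    (by
      have := ((hf.indicator hA).sub (Lp.stronglyMeasurable (e i)).measurable)
      exact this.enorm.aemeasurable) (ENNReal.ofReal ε)
  rw [← eLpNorm_one_eq_lintegral_enorm] at hmarkov
  have hsmall : μ {x | ENNReal.ofReal ε ≤ ‖h x - e i x‖ₑ} ≤ ENNReal.ofReal (ε / 2) :=
    (ENNReal.mul_le_mul_iff_right (by simpa using hε) ENNReal.ofReal_ne_top).1
      (hmarkov.trans hnorm.le)
  have hsub : {x | ε ≤ |f x - e i x|} ⊆
      {x | ENNReal.ofReal ε ≤ ‖h x - e i x‖ₑ} ∪ {x | (N : ℝ) < |f x|} := by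
    intro x hx
    by_cases hxA : |f x| ≤ N
    · left
      have : h x = f x := indicator_of_mem (s := A) hxA f
      rw [mem_ofPred_eq, this, Real.enorm_eq_ofReal_abs]
      exact ENNReal.ofReal_le_ofReal hx
    · exact Or.inr (not_le.1 hxA)
  calc _ ≤ _ := measure_mono hsub
    _ ≤ _ := measure_union_le _ _
    _ ≤ ENNReal.ofReal (ε / 2) + ENNReal.ofReal (ε / 2) := add_le_add hsmall hN.le
    _ = ENNReal.ofReal ε := by
      rw [← ENNReal.ofReal_add (by positivity) (by positivity), add_halves]

lemma measure_setOf_eventually_mem_eq_zero {α : Type*} [MeasurableSpace α] {μ : Measure α}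
    {s : ℕ → Set α} {ε : ℕ → ENNReal} (hε : Tendsto ε atTop (𝓝 0))
    (h : ∃ᶠ n in atTop, μ (s n) ≤ ε n) : μ {x | ∀ᶠ n in atTop, x ∈ s n} = 0 := by
  have hsub : {x | ∀ᶠ n in atTop, x ∈ s n} ⊆ ⋃ N : ℕ, ⋂ n ≥ N, s n := by
    intro x hx
    obtain ⟨N, hN⟩ := eventually_atTop.1 hx
    exact mem_iUnion.2 ⟨N, mem_iInter₂.2 hN⟩
  refine measure_mono_null hsub (measure_iUnion_null fun N => ?_)
  by_contra hne
  obtain ⟨n, hn, hlt, hle⟩ := (h.and_eventually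
    ((hε.eventually (gt_mem_nhds (pos_iff_ne_zero.2 hne))).and (eventually_ge_atTop N))).exists
  exact ((measure_mono (iInter₂_subset n hle)).trans hn).not_gt hlt

/-- Almost no point of the plane lies in infinitely many of the vertical `2⁻ⁿ`-neighbourhoods of
the graphs of the functions `d n`. -/
lemma volume_limsup_graph_neighbourhoods {d : ℕ → ℝ → ℝ} (hd : ∀ n, Measurable (d n)) :
    volume (limsup (fun n => {p : ℝ × ℝ | |p.2 - d n p.1| < (1 / 2) ^ n}) atTop) = 0 := by
  have hmeas : ∀ n, MeasurableSet {p : ℝ × ℝ | |p.2 - d n p.1| < (1 / 2) ^ n} := fun n =>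
    measurableSet_lt (measurable_snd.sub ((hd n).comp measurable_fst)).abs measurable_const
  rw [Measure.volume_eq_prod, Measure.measure_prod_null (.measurableSet_limsup hmeas)]
  refine ae_of_all _ fun x => ?_
  have hsec : Prod.mk x ⁻¹' limsup (fun n => {p : ℝ × ℝ | |p.2 - d n p.1| < (1 / 2) ^ n}) atTop =
      limsup (fun n => Metric.ball (d n x) ((1 / 2) ^ n)) atTop := by
    ext y
    simp only [mem_preimage, mem_limsup_iff_frequently_mem, Metric.mem_ball, Real.dist_eq,
      mem_ofPred_eq]
  simp only [hsec, Pi.zero_apply]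
  refine measure_limsup_atTop_eq_zero ?_
  simp only [Real.volume_ball]
  have hsum : Summable fun n : ℕ => 2 * (1 / 2 : ℝ) ^ n := summable_geometric_two.mul_left 2
  rw [← ENNReal.ofReal_tsum_of_nonneg (fun n => by positivity) hsum]
  exact ENNReal.ofReal_ne_top

lemma covMeager_le_mk {X : Set (ℝ → ℝ)} (hX : ∀ f ∈ X, Measurable f)
    (h : ∀ H : Set (ℝ × ℝ), volume H = 0 → ∀ B : Set ℝ, MeasurableSet B → 0 < volume B →
      ∃ f ∈ X, volume {x | x ∈ B ∧ (x, f x) ∉ H} ≠ 0) : covMeager ≤ #X := by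
  by_contra! hlt
  obtain ⟨d, hd, happrox⟩ := exists_seq_dense_in_measure (volume.restrict (Icc (0 : ℝ) 1))
  have hg : ∀ f : ℝ → ℝ, ∃ g : ℕ → ℕ, Measurable f → ∀ n : ℕ,
      volume.restrict (Icc (0 : ℝ) 1) {x | (1 / 2 : ℝ) ^ n ≤ |f x - d (g n) x|} ≤
        ENNReal.ofReal ((1 / 2) ^ n) := by
    intro f
    by_cases hf : Measurable f
    · choose g hg using fun n : ℕ => happrox f hf ((1 / 2) ^ n) (by positivity)
      exact ⟨g, fun _ => hg⟩
    · exact ⟨0, fun h => absurd h hf⟩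
  choose g hg using hg
  obtain ⟨F, hF⟩ := exists_frequently_eq_of_mk_lt_covMeager (G := g '' X)
    (mk_image_le.trans_lt hlt)
  obtain ⟨f, hfX, hf⟩ := h _ (volume_limsup_graph_neighbourhoods fun n => hd (F n)) (Icc 0 1)
    measurableSet_Icc (by simp)
  have hlim : Tendsto (fun n : ℕ => ENNReal.ofReal ((1 / 2) ^ n)) atTop (𝓝 0) := by
    simpa using ENNReal.tendsto_ofReal
      (tendsto_pow_atTop_nhds_zero_of_lt_one (r := (1 / 2 : ℝ)) (by norm_num) (by norm_num))
  have hnull := measure_setOf_eventually_mem_eq_zero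
    (μ := volume.restrict (Icc (0 : ℝ) 1))
    (s := fun n => {x | (1 / 2 : ℝ) ^ n ≤ |f x - d (F n) x|}) hlim
    ((hF _ (mem_image_of_mem g hfX)).mono fun n hn => by rw [hn]; exact hg f (hX f hfX) n)
  rw [Measure.restrict_apply' measurableSet_Icc] at hnull
  refine hf (measure_mono_null ?_ hnull)
  rintro x ⟨hxB, hx⟩
  simp only [mem_limsup_iff_frequently_mem, mem_ofPred_eq, not_frequently, not_lt] at hx
  exact ⟨hx, hxB⟩

lemma covMeager_le_nonStarN : covMeager ≤ nonStarN := by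
  rw [nonStarN]
  apply le_csInf
  · refine ⟨#{f : ℝ → ℝ | Measurable f}, {f | Measurable f}, rfl, fun f hf => hf,
      fun H hH B hB hB0 => ?_⟩
    have hswap := Measure.measurePreserving_swap (μ := (volume : Measure ℝ))
      (ν := (volume : Measure ℝ)) |>.quasiMeasurePreserving.preimage_null hH
    obtain ⟨y, hy⟩ := (Measure.measure_ae_null_of_prod_null hswap).exists
    refine ⟨fun _ => y, measurable_const, ?_⟩
    change volume (B \ (Prod.mk y ⁻¹' (Prod.swap ⁻¹' H))) ≠ 0
    rw [measure_sdiff_null hy]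
    exact hB0.ne'
  · rintro _ ⟨X, rfl, hX, h⟩
    exact covMeager_le_mk hX h

/-- If `non*(𝒩) ≤ 𝔟` then `non*(𝒩) = cov(ℳ)`. -/
theorem nonStarN_eq_covMeager (h : nonStarN ≤ frakb) : nonStarN = covMeager := by
  refine le_antisymm (le_of_not_gt fun hlt => ?_) covMeager_le_nonStarN
  have hne : { c : Cardinal | ∃ F : Set (Set ℝ), #F = c ∧ (∀ A ∈ F, IsMeagre A) ∧
      ⋃₀ F = Set.univ }.Nonempty :=
    ⟨_, range fun x : ℝ => {x}, rfl, by
      rintro _ ⟨x, rfl⟩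
      exact residual_of_dense_open isOpen_compl_singleton (dense_compl_singleton x),
      eq_univ_of_forall fun x => ⟨{x}, mem_range_self x, mem_singleton x⟩⟩
  obtain ⟨F, hF, hmeagre, hcover⟩ := csInf_mem hne
  change #F = covMeager at hF
  rw [← hF] at hlt
  exact sUnion_ne_univ_of_mk_lt hmeagre (hlt.trans_le h) hlt hcover
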